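/- Let X = lim←(K₁ ←p₁ K₂ ←p₂ ···) be an inverse limit such that for each i: (I) K_i is a polyhedron, and (II) p_i is a quasi-simplicial map that is surjective and n-regular. Fix m and a subcomplex A of K_m, and let X' = lim←(K'_m ←p'_m K'_{m+1} ←p'_{m+1} ···) be the restriction to A, where K'_m = A, K'_{j+1} = p_j^{-1}(K'_j), and p'_j = p_j|_{K'_{j+1}} for j ≥ m. Then each K'_j is a polyhedron, each p'_j is a quasi-simplicial map that is surjective and n-regular, and X' is homeomorphic to π_m^{-1}(A), where π_m: X → K_m is the long projection. -/

import Mathlib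

open Set Metric unitInterval
open scoped ENNReal Classical

noncomputable section

/-! ### Basic extension-theoretic notions -/

/-- A topological space has covering dimension `< n` (order of refinements at most `n`):
every open cover admits an open refinement in which every point belongs to
at most `n` members. -/
def CovDimLT (X : Type*) [TopologicalSpace X] (n : ℕ) : Prop :=
  ∀ U : Set (Set X), (∀ u ∈ U, IsOpen u) → ⋃₀ U = univ →
    ∃ R : Set (Set X), (∀ r ∈ R, IsOpen r) ∧ ⋃₀ R = univ ∧
      (∀ r ∈ R, ∃ u ∈ U, r ⊆ u) ∧
      ∀ x : X, {r ∈ R | x ∈ r}.Finite ∧ {r ∈ R | x ∈ r}.ncard ≤ n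

/-- Lebesgue covering dimension at most `n`. -/
def CovDimLE (X : Type*) [TopologicalSpace X] (n : ℕ) : Prop :=
  CovDimLT X (n + 1)

/-- `X` is an absolute extensor in dimension `n` (an `AE(n)`): every continuous map into `X`
from a closed subset of an at most `n`-dimensional metric space `Y` extends continuously
over all of `Y`. -/
def IsAE.{u, v} (n : ℕ) (X : Type v) [TopologicalSpace X] : Prop :=
  ∀ (Y : Type u) [MetricSpace Y], CovDimLE Y n →
    ∀ A : Set Y, IsClosed A → ∀ f : C(A, X),
      ∃ g : C(Y, X), ∀ a : A, g ↑a = f a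

/-- `X` is an absolute neighborhood extensor in dimension `n` (an `ANE(n)`): every continuous
map into `X` from a closed subset `A` of an at most `n`-dimensional metric space extends
continuously over some open neighborhood of `A`. -/
def IsANE.{u, v} (n : ℕ) (X : Type v) [TopologicalSpace X] : Prop :=
  ∀ (Y : Type u) [MetricSpace Y], CovDimLE Y n →
    ∀ A : Set Y, IsClosed A → ∀ f : C(A, X),
      ∃ (U : Set Y) (_ : IsOpen U) (hAU : A ⊆ U) (g : C(U, X)),
        ∀ (a : Y) (ha : a ∈ A), g ⟨a, hAU ha⟩ = f ⟨a, ha⟩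

/-- `X` is an `ANE(∞)`: an absolute neighborhood extensor for the class of all metric
spaces (no dimension restriction). -/
def IsANEInf.{u, v} (X : Type v) [TopologicalSpace X] : Prop :=
  ∀ (Y : Type u) [MetricSpace Y],
    ∀ A : Set Y, IsClosed A → ∀ f : C(A, X),
      ∃ (U : Set Y) (_ : IsOpen U) (hAU : A ⊆ U) (g : C(U, X)),
        ∀ (a : Y) (ha : a ∈ A), g ⟨a, hAU ha⟩ = f ⟨a, ha⟩

/-! ### Covers -/

/-- An (indexed) family is a cover when its union is everything. -/
def IsCover {ι X : Type*} (F : ι → Set X) : Prop :=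
  (⋃ i, F i) = univ

/-- A cover is an `AE(n)`-cover if the intersection of every (nonempty) subfamily is either
empty or an absolute extensor in dimension `n`. -/
def IsAECover.{u, v, w} (n : ℕ) {ι : Type v} {X : Type w} [TopologicalSpace X]
    (F : ι → Set X) : Prop :=
  IsCover F ∧ ∀ A : Set ι, A.Nonempty →
    (⋂ i ∈ A, F i) = ∅ ∨ IsAE.{u} n (⋂ i ∈ A, F i)

/-- Two covers with the same indexing set are isomorphic if corresponding subfamilies
have nonempty intersections simultaneously. -/
def CoversIsomorphic {ι X Y : Type*} (F : ι → Set X) (G : ι → Set Y) : Prop :=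
  ∀ J : Set ι, (⋂ i ∈ J, F i).Nonempty ↔ (⋂ i ∈ J, G i).Nonempty

/-- A cover is locally finite-dimensional if its nerve is a locally finite-dimensional
simplicial complex: every vertex belongs to simplices of bounded dimension only. -/
def LocallyFinDimCover {ι X : Type*} (F : ι → Set X) : Prop :=
  ∀ i : ι, ∃ N : ℕ, ∀ A : Finset ι, i ∈ A → (⋂ j ∈ A, F j).Nonempty → A.card ≤ N

/-- Two maps are `F`-close when each pair of corresponding values lies in a common
element of `F`. -/
def CoverClose {ι X Y : Type*} (F : ι → Set Y) (f g : X → Y) : Prop :=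
  ∀ x : X, ∃ i : ι, f x ∈ F i ∧ g x ∈ F i

/-- Two maps are `F`-homotopic when they are joined by a homotopy each of whose paths
lies in a single element of `F`. -/
def CoverHomotopic {ι X Y : Type*} [TopologicalSpace X] [TopologicalSpace Y]
    (F : ι → Set Y) (f g : C(X, Y)) : Prop :=
  ∃ H : f.Homotopy g, ∀ x : X, ∃ i : ι, ∀ t : unitInterval, H (t, x) ∈ F i

/-- The mesh of a cover: the supremum of the diameters of its elements. -/
def coverMesh {ι X : Type*} [PseudoEMetricSpace X] (F : ι → Set X) : ℝ≥0∞ :=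
  ⨆ i, EMetric.diam (F i)

/-! ### Homotopy-theoretic notions -/

/-- The function induced by a continuous map on homotopy groups (of index type `N`). -/
def HomotopyGroup.inducedMap {X Y : Type*} [TopologicalSpace X] [TopologicalSpace Y]
    (f : C(X, Y)) (N : Type*) (x : X) :
    HomotopyGroup N X x → HomotopyGroup N Y (f x) :=
  Quotient.map
    (fun g => ⟨f.comp g.1, fun y hy => by
      simp only [ContinuousMap.comp_apply]
      rw [g.2 y hy]⟩)
    (fun g h H => H.elim fun H => ⟨H.compContinuousMap f⟩)

/-- A continuous map is a weak `n`-homotopy equivalence if it induces isomorphisms on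
homotopy groups in all dimensions `< n`, regardless of the choice of basepoint. -/
def IsWeakNHomotopyEquiv {X Y : Type*} [TopologicalSpace X] [TopologicalSpace Y]
    (n : ℕ) (f : C(X, Y)) : Prop :=
  ∀ k < n, ∀ x : X, Function.Bijective (HomotopyGroup.inducedMap f (Fin k) x)

/-- `X` has vanishing homotopy groups in all dimensions `< n`, for every basepoint. -/
def VanishingHomotopyBelow (n : ℕ) (X : Type*) [TopologicalSpace X] : Prop :=
  ∀ k < n, ∀ x : X, Subsingleton (HomotopyGroup (Fin k) X x)

/-- `f` is null-homotopic inside the subset `U`: there is a homotopy, with values in `U`,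
from `f` to a constant map. -/
def NullHomotopicIn {S X : Type*} [TopologicalSpace S] [TopologicalSpace X]
    (f : C(S, X)) (U : Set X) : Prop :=
  ∃ (H : C(S × unitInterval, X)) (c : X),
    (∀ s : S, H (s, 0) = f s) ∧ (∀ s : S, H (s, 1) = c) ∧ ∀ z, H z ∈ U

/-- `X` is locally `k`-connected: every neighborhood `U` of a point contains a
neighborhood `V` of the point such that every map of the `k`-sphere into `V` is
null-homotopic in `U`. -/
def LocallyKConnected (k : ℕ) (X : Type*) [TopologicalSpace X] : Prop :=
  ∀ (x : X) (U : Set X), IsOpen U → x ∈ U →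
    ∃ V : Set X, IsOpen V ∧ x ∈ V ∧
      ∀ f : C(Metric.sphere (0 : EuclideanSpace ℝ (Fin (k + 1))) 1, X),
        (∀ s, f s ∈ V) → NullHomotopicIn f U

/-- `A` is a deformation retract of `B` (both subsets of an ambient space `X`). -/
def IsDeformationRetractOf {X : Type*} [TopologicalSpace X] (A B : Set X) : Prop :=
  A ⊆ B ∧ ∃ H : C(B × unitInterval, X),
    (∀ b : B, H (b, 0) = ↑b) ∧ (∀ b : B, H (b, 1) ∈ A) ∧
    (∀ (b : B) (t : unitInterval), H (b, t) ∈ B) ∧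
    ∀ b : B, (b : X) ∈ A → H (b, 1) = ↑b

/-! ### Simplicial complexes and their metric realizations -/

/-- An abstract simplicial complex on a vertex type `V`. -/
structure SComplex (V : Type*) where
  faces : Set (Finset V)
  nonempty_of_mem : ∀ s ∈ faces, s.Nonempty
  down_closed : ∀ s ∈ faces, ∀ t : Finset V, t ⊆ s → t.Nonempty → t ∈ faces

namespace SComplex

variable {V W : Type*}

/-- The geometric realization with scale `κ` of a simplicial complex, i.e. the polyhedron,
as a subset of `ℓ¹(V)`: nonnegative functions supported on a simplex whose coordinates sum
to `κ` (each vertex `v` is the point `κ·e_v`).  It carries the metric topology induced from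
the `ℓ¹`-norm. -/
def space (K : SComplex V) (κ : ℝ) : Set (lp (fun _ : V => ℝ) 1) :=
  {x | (∀ v, 0 ≤ x v) ∧ (∃ s ∈ K.faces, ∀ v, x v ≠ 0 → v ∈ s) ∧
    HasSum (fun v => x v) κ}

/-- The closed geometric simplex of the realization spanned by a face `s`. -/
def cell (K : SComplex V) (κ : ℝ) (s : Finset V) : Set (K.space κ) :=
  {x | ∀ v, (x : lp (fun _ : V => ℝ) 1) v ≠ 0 → v ∈ s}

/-- The simplices of the barycentric subdivision `βK` are the nonempty finite chains
of faces of `K`. -/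
def IsChainOfFaces (K : SComplex V) (c : Finset (Finset V)) : Prop :=
  c.Nonempty ∧ (∀ s ∈ c, s ∈ K.faces) ∧ ∀ s₁ ∈ c, ∀ s₂ ∈ c, s₁ ⊆ s₂ ∨ s₂ ⊆ s₁

/-- The closed geometric simplex of the barycentric subdivision `βK` spanned by the chain
`c`, viewed inside the realization of `K`: the convex hull of the barycenters of the
faces in `c`. -/
def chainCell (K : SComplex V) (κ : ℝ) (c : Finset (Finset V)) : Set (K.space κ) :=
  {y | ∃ t : Finset V → ℝ, (∀ s, 0 ≤ t s) ∧ (∀ s, t s ≠ 0 → s ∈ c) ∧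
      (∑ s ∈ c, t s) = κ ∧
      ∀ w, (y : lp (fun _ : V => ℝ) 1) w =
        ∑ s ∈ c, (if w ∈ s then t s / (s.card : ℝ) else 0)}

/-- A set of faces forms a subcomplex of `K`. -/
def IsSubcomplex (K : SComplex V) (F : Set (Finset V)) : Prop :=
  F ⊆ K.faces ∧ ∀ s ∈ F, ∀ t : Finset V, t ⊆ s → t.Nonempty → t ∈ F

/-- The point set of the subcomplex with faces `F`, inside the realization of `K`. -/
def subSpace (K : SComplex V) (κ : ℝ) (F : Set (Finset V)) : Set (K.space κ) :=
  {x | ∃ s ∈ F, ∀ v, (x : lp (fun _ : V => ℝ) 1) v ≠ 0 → v ∈ s}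

/-- The barycentric star of a subcomplex `F` in `K`: the union of the simplices of the
barycentric subdivision `βK` that intersect the subcomplex. -/
def bst (K : SComplex V) (κ : ℝ) (F : Set (Finset V)) : Set (K.space κ) :=
  ⋃ c ∈ {c | K.IsChainOfFaces c ∧ (K.chainCell κ c ∩ K.subSpace κ F).Nonempty},
    K.chainCell κ c

/-- The open star of a subcomplex `F` in `K`: the complement of the union of all
simplices of `K` that do not intersect the subcomplex. -/
def ost (K : SComplex V) (κ : ℝ) (F : Set (Finset V)) : Set (K.space κ) :=
  (⋃ s ∈ {s | s ∈ K.faces ∧ K.cell κ s ∩ K.subSpace κ F = ∅}, K.cell κ s)ᶜ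

/-- The open star of a subcomplex `F` taken in the barycentric subdivision `βK`:
the complement of the union of all simplices of `βK` that do not intersect the
subcomplex. -/
def ostBsd (K : SComplex V) (κ : ℝ) (F : Set (Finset V)) : Set (K.space κ) :=
  (⋃ c ∈ {c | K.IsChainOfFaces c ∧ K.chainCell κ c ∩ K.subSpace κ F = ∅},
    K.chainCell κ c)ᶜ

/-- Barycentric star of a vertex. -/
def bstVertex (K : SComplex V) (κ : ℝ) (v : V) : Set (K.space κ) :=
  K.bst κ {({v} : Finset V)}

/-- Open star of a vertex. -/
def ostVertex (K : SComplex V) (κ : ℝ) (v : V) : Set (K.space κ) :=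
  K.ost κ {({v} : Finset V)}

/-- A simplicial complex is locally finite-dimensional if the simplices containing any
given vertex have bounded dimension. -/
def LocallyFiniteDimensional (K : SComplex V) : Prop :=
  ∀ v : V, {v} ∈ K.faces → ∃ N : ℕ, ∀ s ∈ K.faces, v ∈ s → s.card ≤ N

/-- `p` is a simplicial map of the realizations (scales `κ`, `lam`): it is induced by a
vertex map `φ` carrying faces onto faces, extended affinely on each simplex. -/
def IsSimplicialMap (K : SComplex V) (L : SComplex W) (κ lam : ℝ)
    (p : K.space κ → L.space lam) : Prop :=
  ∃ φ : V → W,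
    (∀ s ∈ K.faces, ∃ t ∈ L.faces,
      (∀ v ∈ s, φ v ∈ t) ∧ ∀ w ∈ t, ∃ v ∈ s, φ v = w) ∧
    ∀ (x : K.space κ) (w : W),
      (p x : lp (fun _ : W => ℝ) 1) w =
        (lam / κ) * ∑' v : V, (if φ v = w then (x : lp (fun _ : V => ℝ) 1) v else 0)

/-- `p` is quasi-simplicial: it is simplicial as a map into the barycentric subdivision
`βL`, i.e. induced by a vertex map `φ` from vertices of `K` to faces of `L` (the vertices
of `βL`) carrying each face of `K` into a chain, extended affinely; the formula is the
composition of the simplicial extension with the canonical identification `|βL| = |L|`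
sending the vertex `s` of `βL` to the barycenter of `s`. -/
def IsQuasiSimplicialMap (K : SComplex V) (L : SComplex W) (κ lam : ℝ)
    (p : K.space κ → L.space lam) : Prop :=
  ∃ φ : V → Finset W,
    (∀ v : V, ({v} : Finset V) ∈ K.faces → φ v ∈ L.faces) ∧
    (∀ s ∈ K.faces, ∀ v₁ ∈ s, ∀ v₂ ∈ s, φ v₁ ⊆ φ v₂ ∨ φ v₂ ⊆ φ v₁) ∧
    ∀ (x : K.space κ) (w : W),
      (p x : lp (fun _ : W => ℝ) 1) w =
        (lam / κ) *
          ∑' v : V, (if w ∈ φ v then (x : lp (fun _ : V => ℝ) 1) v / ((φ v).card : ℝ)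
            else 0)

/-- A quasi-simplicial map is `n`-regular if the preimage of every (closed) simplex of
the barycentric subdivision `βL` has vanishing homotopy groups in dimensions `< n`,
regardless of basepoint. -/
def IsNRegularMap (n : ℕ) (K : SComplex V) (L : SComplex W) (κ lam : ℝ)
    (p : K.space κ → L.space lam) : Prop :=
  IsQuasiSimplicialMap K L κ lam p ∧
    ∀ c : Finset (Finset W), L.IsChainOfFaces c →
      VanishingHomotopyBelow n (p ⁻¹' (L.chainCell lam c))

end SComplex

/-! ### Inverse limits -/

/-- The long projection of an inverse limit (realized as the subspace of the product
consisting of all threads) onto its `i`-th coordinate space. -/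
def invLimProj {Z : ℕ → Type*} [∀ i, TopologicalSpace (Z i)]
    (p : ∀ i, C(Z (i + 1), Z i)) (i : ℕ) :
    C({x : ∀ j, Z j // ∀ j, p j (x (j + 1)) = x j}, Z i) :=
  ⟨fun x => x.1 i, (continuous_apply i).comp continuous_subtype_val⟩

/-- The short projections of an inverse sequence: `shortProj p i m : Z (i + m) → Z i`. -/
def shortProj {Z : ℕ → Type*} [∀ i, TopologicalSpace (Z i)]
    (p : ∀ i, C(Z (i + 1), Z i)) (i : ℕ) : ∀ m : ℕ, C(Z (i + m), Z i)
  | 0 => ContinuousMap.id _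
  | m + 1 => (shortProj p i m).comp (p (i + m))

end

namespace SComplex

theorem space_mono {V' : Type*} {F G : SComplex V'} (h : F.faces ⊆ G.faces) (κ' : ℝ) :
    F.space κ' ⊆ G.space κ' := by
  rintro x ⟨h1, ⟨s, hs, hsup⟩, h3⟩
  exact ⟨h1, ⟨s, h hs, hsup⟩, h3⟩

end SComplex

section Restriction

variable {V : ℕ → Type*} (K : ∀ i, SComplex (V i)) (κ : ℕ → ℝ)
  (p : ∀ i, C(((K (i + 1)).space (κ (i + 1))), ((K i).space (κ i))))
  (m : ℕ) (A : Set (Finset (V m)))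

/-- The face sets of the restriction of the inverse sequence to the subcomplex `A` of
`K m`: `F 0 = A`, and `F (j + 1)` consists of the faces of `K (m + j + 1)` that are
mapped by `p (m + j)` into the point set of the subcomplex `F j`; this realizes
`K'_{j+1} = p_j⁻¹(K'_j)`. -/
def restrFaces : ∀ j : ℕ, Set (Finset (V (m + j)))
  | 0 => A
  | j + 1 =>
    {s | s ∈ (K (m + j + 1)).faces ∧
      ⇑(p (m + j)) '' ((K (m + j + 1)).cell (κ (m + j + 1)) s) ⊆
        (K (m + j)).subSpace (κ (m + j)) (restrFaces j)}

theorem restrFaces_subset (hA : (K m).IsSubcomplex A) :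
    ∀ j : ℕ, restrFaces K κ p m A j ⊆ (K (m + j)).faces
  | 0 => hA.1
  | _ + 1 => fun _ hs => hs.1

/-- The restricted complexes `K'_j` of the restriction of the inverse sequence to the
subcomplex `A` of `K m`. -/
def restrComplex (hA : (K m).IsSubcomplex A) (j : ℕ) : SComplex (V (m + j)) where
  faces := restrFaces K κ p m A j
  nonempty_of_mem s hs :=
    (K (m + j)).nonempty_of_mem s (restrFaces_subset K κ p m A hA j hs)
  down_closed := by
    cases j with
    | zero => exact fun s hs t hts htne => hA.2 s hs t hts htne
    | succ j =>
      rintro s hs t hts htne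
      refine ⟨(K (m + j + 1)).down_closed s hs.1 t hts htne, ?_⟩
      rintro y ⟨x, hx, rfl⟩
      exact hs.2 ⟨x, fun v hv => hts (hx v hv), rfl⟩

/-- The restricted bonding maps `p'_j`, i.e. the restrictions of `p (m + j)` to the
realizations of the restricted complexes. -/
noncomputable def restrMap (hA : (K m).IsSubcomplex A) (j : ℕ)
    (x : ((restrComplex K κ p m A hA (j + 1)).space (κ (m + j + 1)))) :
    ((restrComplex K κ p m A hA j).space (κ (m + j))) :=
  let y : ((K (m + j + 1)).space (κ (m + j + 1)) : Set _) :=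
    ⟨x.1, SComplex.space_mono (restrFaces_subset K κ p m A hA (j + 1)) _ x.2⟩
  let z := p (m + j) y
  ⟨z.1, by
    obtain ⟨hnn, ⟨s, hs, hsup⟩, hsum⟩ := x.2
    obtain ⟨t, htF, htsup⟩ := hs.2 ⟨y, fun v hv => hsup v hv, rfl⟩
    exact ⟨z.2.1, ⟨t, htF, htsup⟩, z.2.2.2⟩⟩

end Restriction

namespace SComplex

variable {V W : Type*}

/-- The support of the image of `x` under a quasi-simplicial map is the union of the faces
assigned to the vertices in the support of `x`. -/
theorem quasiSimplicial_apply_ne_zero_iff {K : SComplex V} {L : SComplex W} {κ lam : ℝ}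
    (hκ : 0 < κ) (hlam : 0 < lam) {p : K.space κ → L.space lam} {φ : V → Finset W}
    (hp : ∀ (x : K.space κ) (w : W),
      (p x : lp (fun _ : W => ℝ) 1) w =
        (lam / κ) *
          ∑' v : V, (if w ∈ φ v then (x : lp (fun _ : V => ℝ) 1) v / ((φ v).card : ℝ)
            else 0))
    (x : K.space κ) (w : W) :
    (p x : lp (fun _ : W => ℝ) 1) w ≠ 0 ↔
      ∃ v, (x : lp (fun _ : V => ℝ) 1) v ≠ 0 ∧ w ∈ φ v := by
  obtain ⟨hnn, ⟨s, -, hsup⟩, -⟩ := x.2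
  have hscale : lam / κ ≠ 0 := (div_pos hlam hκ).ne'
  have hzero : ∀ v ∉ s, (if w ∈ φ v then (x : lp (fun _ : V => ℝ) 1) v / ((φ v).card : ℝ)
      else 0) = 0 := by
    intro v hv
    have : (x : lp (fun _ : V => ℝ) 1) v = 0 := by
      by_contra h
      exact hv (hsup v h)
    simp [this]
  rw [hp, tsum_eq_sum hzero, mul_ne_zero_iff, and_iff_right hscale, Ne,
    Finset.sum_eq_zero_iff_of_nonneg]
  · push Not
    constructor
    · rintro ⟨v, -, hv⟩
      split_ifs at hv with hw
      · exact ⟨v, fun h => hv (by simp [h]), hw⟩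
      · exact absurd rfl hv
    · rintro ⟨v, hv, hw⟩
      refine ⟨v, hsup v hv, ?_⟩
      rw [if_pos hw]
      exact div_ne_zero hv (Nat.cast_ne_zero.2 (Finset.card_pos.2 ⟨w, hw⟩).ne')
  · intro v _
    split_ifs
    · exact div_nonneg (hnn v) (Nat.cast_nonneg _)
    · exact le_rfl

/-- The support of a point of a polyhedron of positive scale is a face. -/
theorem exists_face_eq_support {K : SComplex V} {κ : ℝ} (hκ : 0 < κ) (x : K.space κ) :
    ∃ s ∈ K.faces, ∀ v, v ∈ s ↔ (x : lp (fun _ : V => ℝ) 1) v ≠ 0 := by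
  obtain ⟨-, ⟨s, hs, hsup⟩, hsum⟩ := x.2
  have hmem : ∀ v, v ∈ s.filter (fun v => (x : lp (fun _ : V => ℝ) 1) v ≠ 0) ↔
      (x : lp (fun _ : V => ℝ) 1) v ≠ 0 := fun v => by
    rw [Finset.mem_filter, and_iff_right_of_imp (hsup v)]
  refine ⟨_, K.down_closed s hs _ (Finset.filter_subset _ _) ?_, hmem⟩
  by_contra hne
  have hx : ∀ v, (x : lp (fun _ : V => ℝ) 1) v = 0 := by
    intro v
    by_contra h
    exact hne ⟨v, (hmem v).2 h⟩
  have h0 : HasSum (fun v => (x : lp (fun _ : V => ℝ) 1) v) 0 := by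
    simpa only [hx] using (hasSum_zero : HasSum (fun _ : V => (0 : ℝ)) 0)
  exact hκ.ne (h0.unique hsum)

/-- The vertex `κ·e_v` of the realization. -/
theorem single_mem_space {K : SComplex V} {κ : ℝ} (hκ : 0 < κ) {v : V}
    (hv : ({v} : Finset V) ∈ K.faces) :
    (lp.single 1 v κ : lp (fun _ : V => ℝ) 1) ∈ K.space κ := by
  refine ⟨fun w => ?_, ⟨{v}, hv, fun w hw => ?_⟩, ?_⟩
  · rw [lp.single_apply]
    by_cases h : w = v
    · subst h
      simpa using hκ.le
    · simp [h]
  · by_contra h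
    exact hw (lp.single_apply_ne (E := fun _ : V => ℝ) 1 v κ (by simpa using h))
  · simpa only [lp.single_apply_self] using
      hasSum_single v fun w hw => lp.single_apply_ne (E := fun _ : V => ℝ) 1 v κ hw

/-- A simplex of the barycentric subdivision spanned by faces in `F` lies in the point set
of `F`. -/
theorem chainCell_subset_subSpace {K : SComplex V} {κ : ℝ} {F : Set (Finset V)}
    {c : Finset (Finset V)} (hc : K.IsChainOfFaces c) (hF : ∀ s ∈ c, s ∈ F) :
    K.chainCell κ c ⊆ K.subSpace κ F := by
  rintro y ⟨t, -, -, -, hy⟩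
  obtain ⟨u, hu, hmax⟩ := Finset.exists_max_image c Finset.card hc.1
  refine ⟨u, hF u hu, fun w hw => ?_⟩
  rw [hy] at hw
  obtain ⟨s, hs, hne⟩ := Finset.exists_ne_zero_of_sum_ne_zero hw
  have hws : w ∈ s := by
    by_contra h
    exact hne (if_neg h)
  rcases hc.2.2 s hs u hu with h | h
  · exact h hws
  · rwa [Finset.eq_of_subset_of_card_le h (hmax s hs)]

end SComplex

/-- Vanishing of homotopy groups is invariant under homeomorphism. -/
theorem VanishingHomotopyBelow.of_homeomorph {n : ℕ} {X Y : Type*} [TopologicalSpace X]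
    [TopologicalSpace Y] (e : X ≃ₜ Y) (h : VanishingHomotopyBelow n Y) :
    VanishingHomotopyBelow n X := by
  intro k hk x
  have := h k hk (e x)
  refine ⟨fun a b => ?_⟩
  induction a using Quotient.inductionOn with | _ a
  induction b using Quotient.inductionOn with | _ b
  have hab := Subsingleton.elim
    (HomotopyGroup.inducedMap (e : C(X, Y)) (Fin k) x (Quotient.mk _ a))
    (HomotopyGroup.inducedMap (e : C(X, Y)) (Fin k) x (Quotient.mk _ b))
  obtain ⟨H⟩ := Quotient.exact hab
  refine Quotient.sound ⟨(H.compContinuousMap (e.symm : C(Y, X))).cast ?_ ?_⟩ <;>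
  · ext y
    exact e.symm_apply_apply _

section InverseSequence

variable {Z : ℕ → Type*} [∀ i, TopologicalSpace (Z i)] (p : ∀ i, C(Z (i + 1), Z i))

/-- The composite bonding map `Z b → Z a` of an inverse sequence, for `a ≤ b`. -/
def bondingMap (a b : ℕ) (h : a ≤ b) : C(Z b, Z a) :=
  Nat.leRec (motive := fun b _ => C(Z b, Z a)) (ContinuousMap.id _)
    (fun b _ f => f.comp (p b)) h

theorem bondingMap_self (a : ℕ) (x : Z a) : bondingMap p a a le_rfl x = x := by
  simp [bondingMap]

theorem bondingMap_succ_right (a b : ℕ) (h : a ≤ b) (x : Z (b + 1)) :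
    bondingMap p a (b + 1) (Nat.le_succ_of_le h) x = bondingMap p a b h (p b x) := by
  rw [bondingMap, Nat.leRec_succ]
  rfl

theorem bondingMap_succ_left (a b : ℕ) (h : a + 1 ≤ b) (x : Z b) :
    p a (bondingMap p (a + 1) b h x) = bondingMap p a b (Nat.le_of_succ_le h) x := by
  induction b, h using Nat.le_induction with
  | base => rw [bondingMap_self, bondingMap_succ_right p a a le_rfl, bondingMap_self]
  | succ b h ih =>
    rw [bondingMap_succ_right p (a + 1) b h, ih,
      bondingMap_succ_right p a b (Nat.le_of_succ_le h)]

theorem bondingMap_thread {x : ∀ i, Z i} (hx : ∀ i, p i (x (i + 1)) = x i) (a b : ℕ)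
    (h : a ≤ b) : bondingMap p a b h (x b) = x a := by
  induction b, h using Nat.le_induction with
  | base => exact bondingMap_self p a _
  | succ b h ih => rw [bondingMap_succ_right p a b h, hx, ih]

theorem bondingMap_shifted_thread (m : ℕ) {x : ∀ j, Z (m + j)}
    (hx : ∀ j, p (m + j) (x (j + 1)) = x j) (a b : ℕ) (h : a ≤ b) :
    bondingMap p (m + a) (m + b) (Nat.add_le_add_left h m) (x b) = x a := by
  induction b, h using Nat.le_induction with
  | base => exact bondingMap_self p (m + a) _
  | succ b h ih =>
    exact (bondingMap_succ_right p (m + a) (m + b) (Nat.add_le_add_left h m) _).trans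
      (by rw [hx, ih])

/-- Restrict an inverse sequence to subsets `S j ⊆ Z (m + j)`, each of which is the full
preimage of the preceding one.  Threads of the restricted sequence are the same as threads
of the whole sequence whose `m`-th coordinate lies in `S 0`. -/
def shiftedThreadsHomeomorph (m : ℕ) (S : ∀ j, Set (Z (m + j)))
    (hS : ∀ j x, x ∈ S (j + 1) ↔ p (m + j) x ∈ S j) :
    {x : ∀ j, S j // ∀ j, p (m + j) (x (j + 1)) = x j} ≃ₜ
      {z : {x : ∀ i, Z i // ∀ i, p i (x (i + 1)) = x i} // z.1 m ∈ S 0} where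
  toFun x := ⟨⟨fun i => bondingMap p i (m + i) (Nat.le_add_left i m) (x.1 i), fun i => by
      rw [bondingMap_succ_left]
      exact (bondingMap_succ_right p i (m + i) (Nat.le_add_left i m) _).trans
        (by rw [x.2])⟩, by
    change bondingMap p (m + 0) (m + m) _ (x.1 m : Z (m + m)) ∈ S 0
    rw [bondingMap_shifted_thread p m (x := fun j => x.1 j) x.2 0 m (Nat.zero_le m)]
    exact (x.1 0).2⟩
  invFun z := ⟨fun j => ⟨z.1.1 (m + j), by
      induction j with
      | zero => exact z.2
      | succ j ih =>
        refine (hS j _).2 ?_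
        change p (m + j) (z.1.1 (m + j + 1)) ∈ S j
        rwa [z.1.2]⟩, fun j => z.1.2 (m + j)⟩
  left_inv x := by
    refine Subtype.ext (funext fun j => Subtype.ext ?_)
    exact bondingMap_shifted_thread p m (x := fun j => x.1 j) x.2 j (m + j)
      (Nat.le_add_left j m)
  right_inv z := by
    refine Subtype.ext (Subtype.ext (funext fun i => ?_))
    exact bondingMap_thread p z.1.2 i (m + i) (Nat.le_add_left i m)
  continuous_toFun := by
    refine Continuous.subtype_mk (Continuous.subtype_mk (continuous_pi fun i => ?_) _) _
    exact (bondingMap p i (m + i) _).continuous.comp (continuous_subtype_val.comp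
      ((continuous_apply i).comp continuous_subtype_val))
  continuous_invFun := by
    refine Continuous.subtype_mk (continuous_pi fun j => Continuous.subtype_mk ?_ _) _
    exact (continuous_apply (m + j)).comp (continuous_subtype_val.comp continuous_subtype_val)

end InverseSequence

section Restriction

variable {V : ℕ → Type*} (K : ∀ i, SComplex (V i)) (κ : ℕ → ℝ)
  (p : ∀ i, C(((K (i + 1)).space (κ (i + 1))), ((K i).space (κ i))))
  (m : ℕ) (A : Set (Finset (V m)))

/-- The point set of `K'_{j+1}` is the full preimage of the point set of `K'_j`. -/
theorem mem_subSpace_restrFaces_succ_iff (hκ : ∀ i, 0 < κ i)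
    (hquasi : ∀ i, SComplex.IsQuasiSimplicialMap (K (i + 1)) (K i) (κ (i + 1)) (κ i) (p i))
    (j : ℕ) (x : (K (m + j + 1)).space (κ (m + j + 1))) :
    x ∈ (K (m + j + 1)).subSpace (κ (m + j + 1)) (restrFaces K κ p m A (j + 1)) ↔
      p (m + j) x ∈ (K (m + j)).subSpace (κ (m + j)) (restrFaces K κ p m A j) := by
  constructor
  · rintro ⟨s, hs, hsup⟩
    exact hs.2 ⟨x, hsup, rfl⟩
  · rintro ⟨t, ht, htsup⟩
    obtain ⟨φ, -, -, hφ⟩ := hquasi (m + j)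
    have hsupp := SComplex.quasiSimplicial_apply_ne_zero_iff (hκ _) (hκ _) hφ
    obtain ⟨s, hs, hmem⟩ := SComplex.exists_face_eq_support (hκ _) x
    refine ⟨s, ⟨hs, ?_⟩, fun v hv => (hmem v).2 hv⟩
    rintro _ ⟨y, hy, rfl⟩
    refine ⟨t, ht, fun w hw => ?_⟩
    obtain ⟨v, hv, hwv⟩ := (hsupp y w).1 hw
    exact htsup w ((hsupp x w).2 ⟨v, (hmem v).1 (hy v hv), hwv⟩)

/-- The realization of `K'_j` is the point set of `K'_j` inside the realization of
`K (m + j)`. -/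
noncomputable def restrSpaceHomeomorph (hA : (K m).IsSubcomplex A) (j : ℕ) :
    (restrComplex K κ p m A hA j).space (κ (m + j)) ≃ₜ
      (K (m + j)).subSpace (κ (m + j)) (restrFaces K κ p m A j) where
  toFun x := ⟨⟨x.1, SComplex.space_mono (restrFaces_subset K κ p m A hA j) _ x.2⟩, x.2.2.1⟩
  invFun x := ⟨x.1.1, x.1.2.1, x.2, x.1.2.2.2⟩
  left_inv _ := rfl
  right_inv _ := rfl
  continuous_toFun := (continuous_subtype_val.subtype_mk _).subtype_mk _
  continuous_invFun := (continuous_subtype_val.comp continuous_subtype_val).subtype_mk _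

theorem coe_restrSpaceHomeomorph_restrMap (hA : (K m).IsSubcomplex A) (j : ℕ)
    (x : (restrComplex K κ p m A hA (j + 1)).space (κ (m + j + 1))) :
    (restrSpaceHomeomorph K κ p m A hA j (restrMap K κ p m A hA j x)).1 =
      p (m + j) (restrSpaceHomeomorph K κ p m A hA (j + 1) x).1 :=
  rfl

theorem continuous_restrMap (hA : (K m).IsSubcomplex A) (j : ℕ) :
    Continuous (restrMap K κ p m A hA j) := by
  refine Continuous.subtype_mk (continuous_subtype_val.comp ?_) _
  exact (p (m + j)).continuous.comp (continuous_subtype_val.subtype_mk _)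

theorem surjective_restrMap (hκ : ∀ i, 0 < κ i)
    (hquasi : ∀ i, SComplex.IsQuasiSimplicialMap (K (i + 1)) (K i) (κ (i + 1)) (κ i) (p i))
    (hsurj : ∀ i, Function.Surjective (p i)) (hA : (K m).IsSubcomplex A) (j : ℕ) :
    Function.Surjective (restrMap K κ p m A hA j) := by
  intro z
  let z' := restrSpaceHomeomorph K κ p m A hA j z
  obtain ⟨x, hx⟩ := hsurj (m + j) z'.1
  have hmem := (mem_subSpace_restrFaces_succ_iff K κ p m A hκ hquasi j x).2 (hx ▸ z'.2)
  refine ⟨(restrSpaceHomeomorph K κ p m A hA (j + 1)).symm ⟨x, hmem⟩, ?_⟩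
  exact (restrSpaceHomeomorph K κ p m A hA j).injective (Subtype.ext hx)

theorem isQuasiSimplicialMap_restrMap (hκ : ∀ i, 0 < κ i)
    (hquasi : ∀ i, SComplex.IsQuasiSimplicialMap (K (i + 1)) (K i) (κ (i + 1)) (κ i) (p i))
    (hA : (K m).IsSubcomplex A) (j : ℕ) :
    SComplex.IsQuasiSimplicialMap (restrComplex K κ p m A hA (j + 1))
      (restrComplex K κ p m A hA j) (κ (m + j + 1)) (κ (m + j))
      (restrMap K κ p m A hA j) := by
  obtain ⟨φ, hface, hchain, hφ⟩ := hquasi (m + j)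
  refine ⟨φ, fun v hv => ?_, fun s hs => hchain s hs.1, fun x w => hφ _ w⟩
  have hvK : ({v} : Finset (V (m + j + 1))) ∈ (K (m + j + 1)).faces := hv.1
  let e : (K (m + j + 1)).space (κ (m + j + 1)) :=
    ⟨_, SComplex.single_mem_space (hκ (m + j + 1)) hvK⟩
  have hecell : e ∈ (K (m + j + 1)).cell (κ (m + j + 1)) {v} := by
    intro w hw
    by_contra h
    exact hw (lp.single_apply_ne 1 v _ (by simpa using h))
  obtain ⟨t, ht, htsup⟩ := hv.2 ⟨e, hecell, rfl⟩
  refine (restrComplex K κ p m A hA j).down_closed t ht _ (fun w hw => htsup w ?_)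
    ((K (m + j)).nonempty_of_mem _ (hface v hvK))
  refine (SComplex.quasiSimplicial_apply_ne_zero_iff (hκ _) (hκ _) hφ e w).2 ⟨v, ?_, hw⟩
  exact (lp.single_apply_self (E := fun _ : V (m + j + 1) => ℝ) 1 v _).trans_ne (hκ _).ne'

theorem isNRegularMap_restrMap {n : ℕ} (hκ : ∀ i, 0 < κ i)
    (hreg : ∀ i, SComplex.IsNRegularMap n (K (i + 1)) (K i) (κ (i + 1)) (κ i) (p i))
    (hA : (K m).IsSubcomplex A) (j : ℕ) :
    SComplex.IsNRegularMap n (restrComplex K κ p m A hA (j + 1))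
      (restrComplex K κ p m A hA j) (κ (m + j + 1)) (κ (m + j))
      (restrMap K κ p m A hA j) := by
  refine ⟨isQuasiSimplicialMap_restrMap K κ p m A hκ (fun i => (hreg i).1) hA j,
    fun c hc => ?_⟩
  have hcK : (K (m + j)).IsChainOfFaces c :=
    ⟨hc.1, fun s hs => restrFaces_subset K κ p m A hA j (hc.2.1 s hs), hc.2.2⟩
  have hmem : ∀ x, p (m + j) x ∈ (K (m + j)).chainCell (κ (m + j)) c →
      x ∈ (K (m + j + 1)).subSpace (κ (m + j + 1)) (restrFaces K κ p m A (j + 1)) :=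
    fun x hx => (mem_subSpace_restrFaces_succ_iff K κ p m A hκ (fun i => (hreg i).1) j x).2
      (SComplex.chainCell_subset_subSpace hcK hc.2.1 hx)
  refine VanishingHomotopyBelow.of_homeomorph ?_ ((hreg (m + j)).2 c hcK)
  let e := restrSpaceHomeomorph K κ p m A hA (j + 1)
  exact
    { toFun := fun x => ⟨(e x.1).1, x.2⟩
      invFun := fun x => ⟨e.symm ⟨x.1, hmem x.1 x.2⟩, x.2⟩
      left_inv := fun _ => rfl
      right_inv := fun _ => rfl
      continuous_toFun := (continuous_subtype_val.comp
        (e.continuous.comp continuous_subtype_val)).subtype_mk _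
      continuous_invFun := (e.symm.continuous.comp
        (continuous_subtype_val.subtype_mk _)).subtype_mk _ }

/-- Threads of the restricted sequence, viewed as threads of subsets of the original one. -/
noncomputable def restrThreadsHomeomorph (hA : (K m).IsSubcomplex A) :
    {x : ∀ j, ((restrComplex K κ p m A hA j).space (κ (m + j))) //
        ∀ j, restrMap K κ p m A hA j (x (j + 1)) = x j} ≃ₜ
      {x : ∀ j, (K (m + j)).subSpace (κ (m + j)) (restrFaces K κ p m A j) //
        ∀ j, p (m + j) (x (j + 1)) = x j} :=
  (Homeomorph.piCongrRight fun j => restrSpaceHomeomorph K κ p m A hA j).subtype fun x => by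
    refine forall_congr' fun j => ?_
    rw [← (restrSpaceHomeomorph K κ p m A hA j).injective.eq_iff, Subtype.ext_iff,
      coe_restrSpaceHomeomorph_restrMap]
    rfl

end Restriction

/-- **restriction.** Let `X = lim (K₁ ← K₂ ← ⋯)` with each `K_i` a
polyhedron and each `p_i` quasi-simplicial, surjective and `n`-regular.  Fix `m` and a
subcomplex `A ⊆ K m`, and form the restriction `X' = lim (K'_m ← K'_{m+1} ← ⋯)` with
`K'_m = A`, `K'_{j+1} = p_j⁻¹(K'_j)` and `p'_j = p_j|`.  Then the restricted sequence
again consists of polyhedra and quasi-simplicial, surjective, `n`-regular (continuous)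
bonding maps, and `X'` is homeomorphic to `π_m⁻¹(A)`. -/
theorem statement13
    (n : ℕ) (V : ℕ → Type*) (K : ∀ i, SComplex (V i))
    (κ : ℕ → ℝ) (hκ : ∀ i, 0 < κ i)
    (p : ∀ i, C(((K (i + 1)).space (κ (i + 1))), ((K i).space (κ i))))
    (hsurj : ∀ i, Function.Surjective (p i))
    (hreg : ∀ i, SComplex.IsNRegularMap n (K (i + 1)) (K i) (κ (i + 1)) (κ i) (p i))
    (m : ℕ) (A : Set (Finset (V m))) (hA : (K m).IsSubcomplex A) :
    (∀ j : ℕ, Continuous (restrMap K κ p m A hA j)) ∧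
    (∀ j : ℕ, Function.Surjective (restrMap K κ p m A hA j)) ∧
    (∀ j : ℕ, SComplex.IsNRegularMap n
      (restrComplex K κ p m A hA (j + 1)) (restrComplex K κ p m A hA j)
      (κ (m + j + 1)) (κ (m + j)) (restrMap K κ p m A hA j)) ∧
    Nonempty
      ({x : ∀ j, ((restrComplex K κ p m A hA j).space (κ (m + j))) //
          ∀ j, restrMap K κ p m A hA j (x (j + 1)) = x j} ≃ₜ
        {z : {x : ∀ i, ((K i).space (κ i)) // ∀ i, p i (x (i + 1)) = x i} //
          z.1 m ∈ (K m).subSpace (κ m) A}) := by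
  have hquasi := fun i => (hreg i).1
  exact ⟨continuous_restrMap K κ p m A hA, surjective_restrMap K κ p m A hκ hquasi hsurj hA,
    isNRegularMap_restrMap K κ p m A hκ hreg hA,
    ⟨(restrThreadsHomeomorph K κ p m A hA).trans
      (shiftedThreadsHomeomorph (Z := fun i => (K i).space (κ i)) p m
        (fun j => (K (m + j)).subSpace (κ (m + j)) (restrFaces K κ p m A j))
        (mem_subSpace_restrFaces_succ_iff K κ p m A hκ hquasi))⟩⟩
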